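/- Let k be a field of characteristic zero, let R and S be finitely generated commutative k-algebras that are integral domains of Krull dimension one, and let δ and δ' be k-linear derivations of R and S respectively. Let T be a skew polynomial ring R[x;δ] (a k-algebra with an injective k-algebra homomorphism ι : R → T and an element x ∈ T such that every element of T is uniquely a finite sum Σ_i ι(r_i)x^i and x·ι(r) = ι(r)·x + ι(δ(r)) for all r ∈ R), and let T' be a skew polynomial ring S[x';δ'] defined analogously. If T and T' are isomorphic as k-algebras, then R and S are isomorphic as k-algebras. -/

import Mathlib

open Polynomial

set_option linter.unusedSectionVars false

lemma aux_dim_le {A B : Type*} [CommRing A] [CommRing B] [Algebra A B] [Algebra.IsIntegral A B]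
    [FaithfulSMul A B] : ringKrullDim A ≤ ringKrullDim B := by
  refine iSup_le fun l => ?_
  obtain ⟨P, -, hc⟩ := Ideal.exists_ideal_over_prime_of_isIntegral (l.head.asIdeal) (⊥ : Ideal B)
    (by
      intro a ha
      have : algebraMap A B a = 0 := by simpa using ha
      have h0 : a = 0 := by
        apply FaithfulSMul.algebraMap_injective A B
        simpa using this
      simp [h0])
  obtain ⟨hP, hc⟩ := hc
  have : P.LiesOver l.head.asIdeal := ⟨hc.symm⟩
  obtain ⟨L, hL, -⟩ := Ideal.exists_ltSeries_of_hasGoingUp l P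
  rw [← hL]
  exact le_iSup (fun p : LTSeries (PrimeSpectrum B) => (p.length : WithBot ℕ∞)) L

lemma aux_trdeg {k R : Type*} [Field k] [CommRing R] [IsDomain R] [Algebra k R]
    (hfg : Algebra.FiniteType k R) (hdim : ringKrullDim R = 1) : Algebra.trdeg k R ≤ 1 := by
  obtain ⟨s, g, hg, hi⟩ := exists_integral_inj_algHom_of_fg k R
  let := g.toRingHom.toAlgebra
  have : Algebra.IsIntegral (MvPolynomial (Fin s) k) R := ⟨hi⟩
  have : FaithfulSMul (MvPolynomial (Fin s) k) R :=
    (faithfulSMul_iff_algebraMap_injective _ _).2 hg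
  have : IsScalarTower k (MvPolynomial (Fin s) k) R := IsScalarTower.of_algebraMap_eq
    fun x => (g.commutes x).symm
  have h1 := aux_dim_le (A := MvPolynomial (Fin s) k) (B := R)
  rw [hdim, MvPolynomial.ringKrullDim_of_isNoetherianRing,
    ringKrullDim_eq_zero_of_field] at h1
  have hs : s ≤ 1 := by
    rw [zero_add, Nat.card_fin] at h1
    exact_mod_cast h1
  have h2 := lift_trdeg_add_eq k (MvPolynomial (Fin s) k) R
  rw [MvPolynomial.trdeg_of_isDomain, trdeg_eq_zero] at h2
  have h3 : Cardinal.lift (Algebra.trdeg k R) ≤ 1 := by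
    rw [← h2]; simpa using hs
  simpa using h3

def kerD {k R : Type*} [Field k] [CommRing R] [Algebra k R] (Δ : Derivation k R R) :
    Subalgebra k R where
  carrier := {r | Δ r = 0}
  mul_mem' := by intro a b ha hb; simp only [Set.mem_ofPred_eq] at *; simp [ha, hb]
  add_mem' := by intro a b ha hb; simp only [Set.mem_ofPred_eq] at *; simp [ha, hb]
  algebraMap_mem' := by intro a; simp

lemma mem_kerD {k R : Type*} [Field k] [CommRing R] [Algebra k R] (Δ : Derivation k R R) (r : R) :
    r ∈ kerD Δ ↔ Δ r = 0 := Iff.rfl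

section
variable {k R : Type*} [Field k] [CharZero k] [CommRing R] [IsDomain R] [Algebra k R]
  (Δ : Derivation k R R)

lemma iter_pow (t : R) (ht : Δ (Δ t) = 0) (n : ℕ) :
    Δ^[n] (t ^ n) = (n.factorial : R) * (Δ t) ^ n ∧ ∀ m > n, Δ^[m] (t ^ n) = 0 := by
  have hlin : ∀ (m : ℕ) (c a : R), Δ c = 0 → Δ^[m] (c * a) = c * Δ^[m] a := by
    intro m
    induction m with
    | zero => intros; rfl
    | succ m ih =>
      intro c a hc
      rw [Function.iterate_succ_apply, Function.iterate_succ_apply, Derivation.leibniz, hc]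
      simp [ih _ _ hc]
  have key : ∀ n : ℕ, Δ (t ^ (n+1)) = ((n+1 : ℕ) : R) * Δ t * t ^ n := by
    intro n
    rw [Derivation.leibniz_pow]
    simp; ring
  have hc : ∀ n : ℕ, Δ (((n+1 : ℕ) : R) * Δ t) = 0 := by
    intro n
    rw [Derivation.leibniz, ht, Derivation.map_natCast]; simp
  induction n with
  | zero =>
    refine ⟨by simp, fun m hm => ?_⟩
    obtain ⟨m, rfl⟩ : ∃ m', m = m' + 1 := ⟨m - 1, by omega⟩
    rw [Function.iterate_succ_apply]
    simp [iterate_map_zero]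
  | succ n ih =>
    refine ⟨?_, fun m hm => ?_⟩
    · rw [Function.iterate_succ_apply, key, hlin _ _ _ (hc n), ih.1, Nat.factorial_succ]
      push_cast; ring
    · obtain ⟨m, rfl⟩ : ∃ m', m = m' + 1 := ⟨m - 1, by omega⟩
      rw [Function.iterate_succ_apply, key, hlin _ _ _ (hc n), ih.2 m (by omega), mul_zero]

lemma iter_lin (m : ℕ) (c a : R) (hc : Δ c = 0) : Δ^[m] (c * a) = c * Δ^[m] a := by
  induction m generalizing a with
  | zero => rfl
  | succ m ih =>
    rw [Function.iterate_succ_apply, Function.iterate_succ_apply, Derivation.leibniz, hc]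
    simp [ih]

lemma exists_local_slice (h0 : Δ ≠ 0) (hl : ∀ r, ∃ n, Δ^[n] r = 0) :
    ∃ t, Δ t ≠ 0 ∧ Δ (Δ t) = 0 := by
  obtain ⟨r, hr⟩ : ∃ r, Δ r ≠ 0 := by
    by_contra! h; exact h0 (Derivation.ext (by simpa using h))
  classical
  have hn := Nat.find_spec (hl r)
  have hm := fun m => Nat.find_min (hl r) (m := m)
  generalize Nat.find (hl r) = n at hn hm
  match n, hn, hm with
  | 0, hn, _ => simp at hn; simp [hn] at hr
  | 1, hn, _ => exact absurd hn hr
  | n+2, hn, hm =>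
    refine ⟨Δ^[n] r, ?_, ?_⟩
    · rw [← Function.iterate_succ_apply' (⇑Δ)]; exact hm (n+1) (by omega)
    · rw [← Function.iterate_succ_apply' (⇑Δ), ← Function.iterate_succ_apply' (⇑Δ)]; exact hn

lemma transc (t : R) (h1 : Δ t ≠ 0) (ht : Δ (Δ t) = 0) : Transcendental (kerD Δ) t := by
  have : CharZero R := charZero_of_injective_algebraMap (algebraMap k R).injective
  rw [transcendental_iff]
  intro p hp
  by_contra hne
  have h := congrArg (Δ^[p.natDegree]) hp
  rw [aeval_eq_sum_range, iterate_map_zero] at h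
  rw [show ∀ n (s : Finset ℕ) (f : ℕ → R), Δ^[n] (∑ i ∈ s, f i) = ∑ i ∈ s, Δ^[n] (f i) by
    intro n s f
    induction n generalizing f with
    | zero => rfl
    | succ n ih => simp only [Function.iterate_succ_apply]; rw [map_sum, ih],
    Finset.sum_range_succ, Finset.sum_eq_zero, zero_add] at h
  · rw [Algebra.smul_def, iter_lin Δ _ (algebraMap (kerD Δ) R _) _ (p.coeff p.natDegree).2, (iter_pow Δ t ht _).1] at h
    have h2 : algebraMap (kerD Δ) R (p.coeff p.natDegree) ≠ 0 := by
      intro h3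
      apply hne
      rw [← leadingCoeff_eq_zero]
      exact Subtype.ext h3
    have : ((p.natDegree).factorial : R) ≠ 0 := by exact_mod_cast Nat.factorial_ne_zero _
    exact mul_ne_zero h2 (mul_ne_zero this (pow_ne_zero _ h1)) h
  · intro i hi
    rw [Algebra.smul_def, iter_lin Δ _ (algebraMap (kerD Δ) R _) _ (p.coeff i).2, (iter_pow Δ t ht i).2 _
      (by simpa using hi), mul_zero]

lemma ker_alg (hfg : Algebra.FiniteType k R) (hdim : ringKrullDim R = 1)
    (h0 : Δ ≠ 0) (hl : ∀ r, ∃ n, Δ^[n] r = 0) : Algebra.IsAlgebraic k (kerD Δ) := by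
  obtain ⟨t, h1, ht⟩ := exists_local_slice Δ h0 hl
  have h2 := trdeg_add_eq k (kerD Δ) (A := R)
  have h3 := aux_trdeg hfg hdim
  have h4 : Algebra.trdeg (kerD Δ) R ≠ 0 := by
    intro h
    have := trdeg_eq_zero_iff.1 h
    exact transc Δ t h1 ht (Algebra.IsAlgebraic.isAlgebraic t)
  rw [← trdeg_eq_zero_iff]
  by_contra h5
  have h6 := Cardinal.one_le_iff_ne_zero.2 h4
  have h7 := Cardinal.one_le_iff_ne_zero.2 h5
  have h8 := (add_le_add h7 h6).trans (h2.le.trans h3)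
  norm_num at h8

lemma equiv_poly (hfg : Algebra.FiniteType k R) (hdim : ringKrullDim R = 1)
    (h0 : Δ ≠ 0) (hl : ∀ r, ∃ n, Δ^[n] r = 0) : Nonempty ((kerD Δ)[X] ≃ₐ[k] R) := by
  have : CharZero R := charZero_of_injective_algebraMap (algebraMap k R).injective
  obtain ⟨t, h1, ht⟩ := exists_local_slice Δ h0 hl
  have := ker_alg Δ hfg hdim h0 hl
  have hF : IsField (kerD Δ) := isField_of_isIntegral_of_isField' (Field.toIsField k)
  obtain ⟨u, hu⟩ := hF.mul_inv_cancel (a := ⟨Δ t, ht⟩) (by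
    intro h; exact h1 (congrArg Subtype.val h))
  have hu' : Δ t * (u : R) = 1 := congrArg Subtype.val hu
  have hΔu : Δ (u : R) = 0 := u.2
  have hs : Δ (u * t) = 1 := by
    rw [Derivation.leibniz, hΔu]; simp [mul_comm _ (Δ t), hu']
  set s : R := u * t
  have hss : Δ (Δ s) = 0 := by rw [hs]; simp
  have htr := transc Δ s (by rw [hs]; exact one_ne_zero) hss
  have hinj : Function.Injective (aeval (R := kerD Δ) s) := transcendental_iff_injective.1 htr
  have hsurj : ∀ n (r : R), Δ^[n] r = 0 → ∃ p : (kerD Δ)[X], aeval s p = r := by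
    intro n
    induction n with
    | zero => intro r hr; exact ⟨0, by simpa using hr.symm⟩
    | succ n ih =>
      intro r hr
      obtain ⟨f, hf⟩ := hF.mul_inv_cancel (a := (n.factorial : kerD Δ)) (by
        intro h
        have : (n.factorial : R) = 0 := by simpa using congrArg Subtype.val h
        exact Nat.factorial_ne_zero n (by exact_mod_cast this))
      have hf' : (n.factorial : R) * (f : R) = 1 := by simpa using congrArg Subtype.val hf
      have hΔf : Δ (f : R) = 0 := f.2
      let c : kerD Δ := ⟨Δ^[n] r, by
        rw [mem_kerD, ← Function.iterate_succ_apply' (⇑Δ)]; exact hr⟩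
      obtain ⟨p, hp⟩ := ih (r - (f * c : kerD Δ) * s ^ n) (by
        rw [iterate_map_sub, iter_lin Δ _ _ _ (f * c).2, (iter_pow Δ s hss n).1, hs]
        simp only [c, MulMemClass.coe_mul]
        linear_combination (-Δ^[n] r) * hf')
      refine ⟨p + C (f * c) * X ^ n, ?_⟩
      simp only [map_add, map_mul, hp, aeval_C, map_pow, aeval_X]
      simp [Algebra.algebraMap_eq_smul_one, Subalgebra.smul_def]
  refine ⟨AlgEquiv.ofBijective ((aeval (R := kerD Δ) s).restrictScalars k) ⟨hinj, fun r => ?_⟩⟩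
  obtain ⟨n, hn⟩ := hl r
  exact hsurj n r hn
end

section
variable {R : Type*} [CommRing R]

def PP (d : ℕ) (Δ : R → R) (c : R) : ℕ → ℕ → R → R
  | _, 0, r => r
  | n, m + 1, r => PP d Δ c (n + d) m (Δ r + n * c * r)

variable (d : ℕ) {Δ : R → R} (c : R)

lemma PP_add (ha : ∀ a b, Δ (a + b) = Δ a + Δ b) (n m : ℕ) (a b : R) :
    PP d Δ c n m (a + b) = PP d Δ c n m a + PP d Δ c n m b := by
  induction m generalizing n a b with
  | zero => rfl
  | succ m ih =>
    simp only [PP]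
    rw [← ih, ha]; congr 1; ring

lemma PP_zero (ha : ∀ a b, Δ (a + b) = Δ a + Δ b) (n m : ℕ) : PP d Δ c n m 0 = 0 := by
  have := PP_add d c ha n m 0 0
  simpa using this

lemma PP_succ (ha : ∀ a b, Δ (a + b) = Δ a + Δ b) (n m j : ℕ) (r : R)
    (h : PP d Δ c n m r = 0) : PP d Δ c n (m + j) r = 0 := by
  induction m generalizing n r with
  | zero =>
    have : r = 0 := h
    rw [this, PP_zero d c ha]
  | succ m ih =>
    rw [show m + 1 + j = (m + j) + 1 by ring]
    exact ih _ _ h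

lemma PP_leib (ha : ∀ a b, Δ (a + b) = Δ a + Δ b) (hm : ∀ a b, Δ (a * b) = Δ a * b + a * Δ b)
    (N : ℕ) : ∀ (i j n m : ℕ) (a b : R), i + j = N →
      PP d Δ c n (i + 1) a = 0 → PP d Δ c m (j + 1) b = 0 →
      ∃ K : ℕ, 0 < K ∧ PP d Δ c (n + m) N (a * b) = K * (PP d Δ c n i a * PP d Δ c m j b) := by
  induction N with
  | zero =>
    intro i j n m a b hij h1 h2
    obtain ⟨rfl, rfl⟩ : i = 0 ∧ j = 0 := by omega
    exact ⟨1, one_pos, by simp [PP]⟩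
  | succ N ih =>
    intro i j n m a b hij h1 h2
    have e : PP d Δ c (n + m) (N + 1) (a * b) =
        PP d Δ c (n + d + m) N ((Δ a + n * c * a) * b) +
        PP d Δ c (n + (m + d)) N (a * (Δ b + m * c * b)) := by
      rw [show n + (m + d) = n + d + m by ring, ← PP_add d c ha]
      simp only [PP]
      rw [hm, show n + m + d = n + d + m by ring]
      congr 1; push_cast; ring
    have t1 : ∃ K : ℕ, (0 < i → 0 < K) ∧ PP d Δ c (n + d + m) N ((Δ a + n * c * a) * b)
        = K * (PP d Δ c n i a * PP d Δ c m j b) := by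
      rcases i with _ | i
      · have : Δ a + n * c * a = 0 := h1
        exact ⟨0, by simp, by rw [this, zero_mul, PP_zero d c ha]; simp⟩
      · obtain ⟨K, hK, h⟩ := ih i j (n + d) m (Δ a + n * c * a) b (by omega) h1 h2
        exact ⟨K, fun _ => hK, h⟩
    have t2 : ∃ K : ℕ, (0 < j → 0 < K) ∧ PP d Δ c (n + (m + d)) N (a * (Δ b + m * c * b))
        = K * (PP d Δ c n i a * PP d Δ c m j b) := by
      rcases j with _ | j
      · have : Δ b + m * c * b = 0 := h2
        exact ⟨0, by simp, by rw [this, mul_zero, PP_zero d c ha]; simp⟩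
      · obtain ⟨K, hK, h⟩ := ih i j n (m + d) a (Δ b + m * c * b) (by omega) h1 h2
        exact ⟨K, fun _ => hK, h⟩
    obtain ⟨K1, hK1, e1⟩ := t1
    obtain ⟨K2, hK2, e2⟩ := t2
    refine ⟨K1 + K2, ?_, by rw [e, e1, e2]; push_cast; ring⟩
    rcases Nat.eq_zero_or_pos i with h | h
    · have := hK2 (by omega); omega
    · have := hK1 h; omega

lemma PP_c_zero [IsDomain R] [CharZero R] (ha : ∀ a b, Δ (a + b) = Δ a + Δ b)
    (hm : ∀ a b, Δ (a * b) = Δ a * b + a * Δ b)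
    (hl : ∀ n r, ∃ m, PP d Δ c n m r = 0) : c = 0 := by
  by_contra hc
  classical
  have key : ∀ n r, r ≠ 0 → ∃ m, PP d Δ c n (m + 1) r = 0 ∧ PP d Δ c n m r ≠ 0 := by
    intro n r hr
    have h1 := Nat.find_spec (hl n r)
    have h2 := fun m => Nat.find_min (hl n r) (m := m)
    generalize Nat.find (hl n r) = q at h1 h2
    rcases q with _ | q
    · exact absurd h1 hr
    · exact ⟨q, h1, h2 q (by omega)⟩
  obtain ⟨i, hi, hi'⟩ := key 1 1 one_ne_zero
  obtain ⟨j, hj, hj'⟩ := key d c hc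
  obtain ⟨K, hK, h⟩ := PP_leib d c ha hm (i + j) i j 1 d 1 c rfl hi hj
  have h0 : PP d Δ c 1 (i + 1 + j) 1 = 0 := PP_succ d c ha _ _ _ _ hi
  have hΔ1 : Δ 1 = 0 := by have := hm 1 1; simpa using this
  rw [show i + 1 + j = (i + j) + 1 by ring] at h0
  simp only [PP, hΔ1] at h0
  rw [show (0 + ((1 : ℕ) : R) * c * 1) = 1 * c by push_cast; ring, h] at h0
  exact mul_ne_zero (by exact_mod_cast hK.ne') (mul_ne_zero hi' hj') h0
end

structure Sk (k R T : Type*) [Field k] [CommRing R] [Algebra k R] [Ring T] [Algebra k T]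
    (δ : Derivation k R R) (ι : R →ₐ[k] T) (x : T) where
  Φ : R[X] ≃ₗ[k] T
  hΦ : ∀ r n, Φ (monomial n r) = ι r * x ^ n
  hcomm : ∀ r : R, x * ι r = ι r * x + ι (δ r)

lemma exists_Sk {k R T : Type*} [Field k] [CommRing R] [Algebra k R] [Ring T] [Algebra k T]
    (δ : Derivation k R R) (ι : R →ₐ[k] T) (x : T)
    (hrep : ∀ t : T, ∃! b : ℕ →₀ R, t = b.sum fun i r => ι r * x ^ i)
    (hcomm : ∀ r : R, x * ι r = ι r * x + ι (δ r)) : Nonempty (Sk k R T δ ι x) := by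
  let f : R[X] →ₗ[k] T :=
    { toFun := fun p => p.sum fun i r => ι r * x ^ i
      map_add' := by
        intro p q
        apply Polynomial.sum_add_index <;> simp [add_mul]
      map_smul' := by
        intro c p
        rw [Polynomial.sum_smul_index' _ _ _ (by simp)]
        simp [Polynomial.sum_def, Finset.smul_sum] }
  have hf : Function.Bijective f := by
    constructor
    · intro p q h
      obtain ⟨b, hb, hu⟩ := hrep (f p)
      have h1 := hu p.toFinsupp.coeff rfl
      have h2 := hu q.toFinsupp.coeff h
      ext n
      exact DFunLike.congr_fun (h1.trans h2.symm) n
    · intro t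
      obtain ⟨b, hb, hu⟩ := hrep t
      exact ⟨⟨⟨b⟩⟩, hb.symm⟩
  exact ⟨⟨LinearEquiv.ofBijective f hf, by
    intro r n
    simp [f, Polynomial.sum_monomial_index], hcomm⟩⟩

namespace Sk
variable {k R T : Type*} [Field k] [CommRing R] [Algebra k R] [Ring T] [Algebra k T]
    {δ : Derivation k R R} {ι : R →ₐ[k] T} {x : T} (E : Sk k R T δ ι x)

noncomputable def cf (n : ℕ) : T →ₗ[k] R := (Polynomial.lcoeff R n).restrictScalars k ∘ₗ E.Φ.symm.toLinearMap

lemma cf_Φ (n : ℕ) (p : R[X]) : E.cf n (E.Φ p) = p.coeff n := by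
  simp [cf]

lemma ext_cf {s t : T} (h : ∀ n, E.cf n s = E.cf n t) : s = t := by
  apply E.Φ.symm.injective
  ext n
  exact h n

lemma cf_mono (r : R) (i n : ℕ) : E.cf n (ι r * x ^ i) = if i = n then r else 0 := by
  rw [← E.hΦ, cf_Φ, coeff_monomial]

/-- induction on monomials -/
lemma ind (E : Sk k R T δ ι x) {P : T → Prop} (hm : ∀ r n, P (ι r * x ^ n)) (ha : ∀ s t, P s → P t → P (s + t))
    (t : T) : P t := by
  obtain ⟨p, rfl⟩ := E.Φ.surjective t
  induction p using Polynomial.induction_on' with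
  | add p q hp hq => rw [map_add]; exact ha _ _ hp hq
  | monomial n r => rw [E.hΦ]; exact hm r n

lemma cf_ι_mul (r : R) (t : T) (n : ℕ) : E.cf n (ι r * t) = r * E.cf n t := by
  induction t using E.ind with
  | hm s i =>
    rw [← mul_assoc, ← map_mul, cf_mono, cf_mono]; split_ifs <;> simp
  | ha s t hs ht => simp only [mul_add, map_add, hs, ht]

lemma x_mono (E : Sk k R T δ ι x) (r : R) (i : ℕ) : x * (ι r * x ^ i) = ι r * x ^ (i + 1) + ι (δ r) * x ^ i := by
  rw [← mul_assoc, E.hcomm, add_mul, mul_assoc, pow_succ']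

lemma cf_x_mul_succ (t : T) (n : ℕ) : E.cf (n + 1) (x * t) = E.cf n t + δ (E.cf (n + 1) t) := by
  induction t using E.ind with
  | hm s i =>
    rw [E.x_mono, map_add, cf_mono, cf_mono, cf_mono, cf_mono]
    by_cases h : i = n + 1
    · subst h; simp
    · simp [h]
  | ha s t hs ht => simp only [mul_add, map_add, hs, ht]; ring

lemma cf_x_mul_zero (t : T) : E.cf 0 (x * t) = δ (E.cf 0 t) := by
  induction t using E.ind with
  | hm s i =>
    rw [E.x_mono, map_add, cf_mono, cf_mono, cf_mono]
    by_cases h : i = 0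
    · subst h; simp
    · simp [h]
  | ha s t hs ht => simp only [mul_add, map_add, hs, ht]

def L (n : ℕ) (t : T) (v : R) : Prop := (∀ m > n, E.cf m t = 0) ∧ E.cf n t = v

variable {E}
lemma L.add {n : ℕ} {s t : T} {v w : R} (h : E.L n s v) (h' : E.L n t w) :
    E.L n (s + t) (v + w) :=
  ⟨fun m hm => by rw [map_add, h.1 m hm, h'.1 m hm, add_zero], by rw [map_add, h.2, h'.2]⟩

lemma L.up {n m : ℕ} {t : T} {v : R} (h : E.L n t v) (hm : n < m) : E.L m t 0 :=
  ⟨fun j hj => h.1 j (hm.trans hj), h.1 m hm⟩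

lemma L.ι_mul {n : ℕ} {t : T} {v : R} (r : R) (h : E.L n t v) : E.L n (ι r * t) (r * v) :=
  ⟨fun m hm => by rw [cf_ι_mul, h.1 m hm, mul_zero], by rw [cf_ι_mul, h.2]⟩

lemma L.x_mul {n : ℕ} {t : T} {v : R} (h : E.L n t v) : E.L (n + 1) (x * t) v := by
  refine ⟨fun m hm => ?_, ?_⟩
  · obtain ⟨m, rfl⟩ : ∃ m', m = m' + 1 := ⟨m - 1, by omega⟩
    rw [cf_x_mul_succ, h.1 m (by omega), h.1 (m + 1) (by omega)]; simp
  · rw [cf_x_mul_succ, h.2, h.1 (n + 1) (by omega)]; simp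

lemma L.xpow_mul {n : ℕ} {t : T} {v : R} (h : E.L n t v) (i : ℕ) : E.L (i + n) (x ^ i * t) v := by
  induction i with
  | zero => simpa using h
  | succ i ih =>
    rw [pow_succ', mul_assoc, show i + 1 + n = (i + n) + 1 by ring]; exact ih.x_mul

variable (E)
lemma L_mono (r : R) (i : ℕ) : E.L i (ι r * x ^ i) r :=
  ⟨fun m hm => by rw [cf_mono, if_neg (by omega)], by rw [cf_mono, if_pos rfl]⟩

lemma L_ι (r : R) : E.L 0 (ι r) r := by simpa using E.L_mono r 0
lemma L_xpow (i : ℕ) : E.L i (x ^ i) 1 := by simpa using E.L_mono 1 i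
lemma L_x : E.L 1 x 1 := by simpa using E.L_xpow 1
lemma L_zero (n : ℕ) : E.L n 0 0 := ⟨fun m _ => map_zero _, map_zero _⟩

variable {E}
lemma L.eq_ι {t : T} {v : R} (h : E.L 0 t v) : t = ι v := by
  apply E.ext_cf
  intro n
  rcases Nat.eq_zero_or_pos n with rfl | hn
  · rw [h.2, (E.L_ι v).2]
  · rw [h.1 n hn, (E.L_ι v).1 n hn]

lemma L.peel {n : ℕ} {t : T} {v : R} (h : E.L (n + 1) t v) :
    ∃ t' v', E.L n t' v' ∧ t = t' + ι v * x ^ (n + 1) := by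
  refine ⟨t - ι v * x ^ (n + 1), _, ⟨fun m hm => ?_, rfl⟩, by abel⟩
  rw [map_sub, cf_mono]
  split_ifs with hh
  · rw [← hh, h.2, sub_self]
  · rw [h.1 m (by omega), sub_zero]

lemma L.mul {m n : ℕ} {s t : T} {v w : R} (h : E.L m s v) (h' : E.L n t w) :
    E.L (m + n) (s * t) (v * w) := by
  induction m generalizing s v with
  | zero =>
    rw [h.eq_ι, zero_add]; exact h'.ι_mul v
  | succ m ih =>
    obtain ⟨s', v', hs', rfl⟩ := h.peel
    have h1 := (ih hs').up (show m + n < m + 1 + n by omega)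
    have h2 := (h'.xpow_mul (m + 1)).ι_mul v
    rw [← mul_assoc] at h2
    simpa [add_mul] using h1.add h2

variable (E)
lemma exists_bound (t : T) : ∃ N, ∀ m > N, E.cf m t = 0 := by
  refine ⟨(E.Φ.symm t).natDegree, fun m hm => ?_⟩
  exact coeff_eq_zero_of_natDegree_lt hm

/-- partial derivative in x -/
noncomputable def pd : T →ₗ[k] T :=
  E.Φ.toLinearMap ∘ₗ (Polynomial.derivative (R := R)).restrictScalars k ∘ₗ E.Φ.symm.toLinearMap

lemma cf_pd (t : T) (n : ℕ) : E.cf n (E.pd t) = E.cf (n + 1) t * (n + 1) := by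
  obtain ⟨p, rfl⟩ := E.Φ.surjective t
  simp [pd, cf_Φ, coeff_derivative]

lemma pd_ι (r : R) : E.pd (ι r) = 0 := by
  apply E.ext_cf; intro n
  rw [cf_pd, (E.L_ι r).1 _ (by omega)]; simp

lemma pd_leib (a b : T) : E.pd (a * b) = E.pd a * b + a * E.pd b := by
  have hι : ∀ r b, E.pd (ι r * b) = ι r * E.pd b := by
    intro r b
    apply E.ext_cf; intro n
    rw [cf_pd, cf_ι_mul, cf_ι_mul, cf_pd, mul_assoc]
  have hx : ∀ b, E.pd (x * b) = b + x * E.pd b := by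
    intro b
    apply E.ext_cf; intro n
    rw [cf_pd, map_add, cf_x_mul_succ]
    rcases n with _ | n
    · rw [cf_x_mul_zero, cf_pd]; simp
    · rw [cf_x_mul_succ, cf_pd, cf_pd]
      have : δ (E.cf (n + 1 + 1) b * ((n + 1 : ℕ) + 1)) = δ (E.cf (n + 1 + 1) b) * ((n + 1 : ℕ) + 1) := by
        have h := δ.leibniz (E.cf (n + 1 + 1) b) ((n + 1 + 1 : ℕ) : R)
        rw [Derivation.map_natCast] at h
        push_cast at h ⊢
        rw [h]; simp [mul_comm]
      rw [this]; push_cast; ring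
  have hxp : ∀ i b, E.pd (x ^ i * b) = E.pd (x ^ i) * b + x ^ i * E.pd b := by
    intro i
    induction i with
    | zero =>
      intro b
      have : E.pd (1 : T) = 0 := by simpa using E.pd_ι 1
      simp [this]
    | succ i ih =>
      intro b
      rw [pow_succ', mul_assoc, hx, ih, hx]; noncomm_ring
  induction a using E.ind with
  | hm r i => rw [mul_assoc, hι, hxp, hι]; noncomm_ring
  | ha s t hs ht => rw [add_mul, map_add, hs, ht, map_add]; noncomm_ring

lemma pd_nil (t : T) : ∃ n, (E.pd)^[n] t = 0 := by
  obtain ⟨N, hN⟩ := E.exists_bound t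
  have : ∀ N t, (∀ m ≥ N, E.cf m t = 0) → (E.pd)^[N] t = 0 := by
    intro N
    induction N with
    | zero => intro t h; apply E.ext_cf; intro n; simpa using h n
    | succ N ih =>
      intro t h
      rw [Function.iterate_succ_apply]
      apply ih
      intro m hm
      rw [cf_pd, h (m + 1) (by omega), zero_mul]
  exact ⟨N + 1, this _ _ fun m hm => hN m (by omega)⟩

lemma pd_ker [CharZero k] [IsDomain R] (t : T) (h : E.pd t = 0) : ∃ r, ι r = t := by
  have : CharZero R := charZero_of_injective_algebraMap (algebraMap k R).injective
  refine ⟨E.cf 0 t, (L.eq_ι (E := E) ⟨fun m hm => ?_, rfl⟩).symm⟩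
  obtain ⟨m, rfl⟩ : ∃ m', m = m' + 1 := ⟨m - 1, by omega⟩
  have h1 := E.cf_pd t m
  rw [h, map_zero] at h1
  have h2 : ((m : R) + 1) ≠ 0 := by exact_mod_cast m.succ_ne_zero
  exact (mul_eq_zero.1 h1.symm).resolve_right h2


lemma D_one (D : T →ₗ[k] T) (hD : ∀ a b, D (a * b) = D a * b + a * D b) : D 1 = 0 := by
  have := hD 1 1; simpa using this

lemma L_D (D : T →ₗ[k] T) (hD : ∀ a b, D (a * b) = D a * b + a * D b) {d : ℕ} (h1 : ∀ r m, d < m → E.cf m (D (ι r)) = 0) (h2 : ∀ m > d + 1, E.cf m (D x) = 0)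
    {n : ℕ} {t : T} {v : R} (h : E.L n t v) :
    E.L (n + d) (D t) (E.cf d (D (ι v)) + n * E.cf (d + 1) (D x) * v) := by
  have hx : ∀ i : ℕ, E.L (i + d) (D (x ^ i)) (i * E.cf (d + 1) (D x)) := by
    intro i
    induction i with
    | zero => rw [pow_zero, D_one D hD]; simpa using E.L_zero _
    | succ i ih =>
      rw [pow_succ, hD]
      have a := ih.mul E.L_x
      have b : E.L (d + 1) (D x) _ := ⟨h2, rfl⟩
      have b := (E.L_xpow i).mul b
      have := (show i + d + 1 = i + (d + 1) by ring) ▸ a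
      convert this.add b using 1
      · ring
      · push_cast; ring
  have hm : ∀ (i : ℕ) r, E.L (i + d) (D (ι r * x ^ i))
      (E.cf d (D (ι r)) + i * E.cf (d + 1) (D x) * r) := by
    intro i r
    rw [hD]
    have a : E.L d (D (ι r)) _ := ⟨h1 r, rfl⟩
    have a := a.mul (E.L_xpow i)
    have b := (hx i).ι_mul r
    rw [add_comm d i] at a
    convert a.add b using 1
    ring
  induction n generalizing t v with
  | zero => rw [h.eq_ι]; simpa using hm 0 v
  | succ n ih =>
    obtain ⟨t', v', ht', rfl⟩ := h.peel
    have a := (ih ht').up (show n + d < n + 1 + d by omega)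
    rw [map_add]
    simpa using a.add (hm (n + 1) v)

lemma exists_d (E : Sk k R T δ ι x) (D : T →ₗ[k] T) (hD : ∀ a b, D (a * b) = D a * b + a * D b) (hfg : Algebra.FiniteType k R) : ∃ d, (∀ r m, d < m → E.cf m (D (ι r)) = 0) ∧
    ∀ m > d + 1, E.cf m (D x) = 0 := by
  obtain ⟨s, hs⟩ := hfg.out
  choose N hN using E.exists_bound
  refine ⟨(s.sup fun r => N (D (ι r))) + N (D x), ?_, fun m hm => hN _ _ (by omega)⟩
  set d := (s.sup fun r => N (D (ι r))) + N (D x)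
  intro r
  have hr : r ∈ Algebra.adjoin k (s : Set R) := by rw [hs]; trivial
  induction hr using Algebra.adjoin_induction with
  | mem r hr =>
    intro m hm
    apply hN
    have := Finset.le_sup (f := fun r => N (D (ι r))) hr
    omega
  | algebraMap c =>
    intro m hm
    rw [AlgHom.commutes, Algebra.algebraMap_eq_smul_one, map_smul, D_one D hD]; simp
  | add a b _ _ ha hb => intro m hm; rw [map_add, map_add, map_add, ha m hm, hb m hm, add_zero]
  | mul a b _ _ ha hb =>
    intro m hm
    rw [map_mul, hD]
    have a1 : E.L d (D (ι a)) _ := ⟨ha, rfl⟩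
    have b1 : E.L d (D (ι b)) _ := ⟨hb, rfl⟩
    have := (a1.mul (E.L_ι b)).add (b1.ι_mul a)
    exact this.1 m hm

lemma main_deriv (E : Sk k R T δ ι x) (D : T →ₗ[k] T) (hD : ∀ a b, D (a * b) = D a * b + a * D b) [CharZero k] [IsDomain R] (hfg : Algebra.FiniteType k R)
    (hN : ∀ t, ∃ n, D^[n] t = 0) (hne : ∃ r, D (ι r) ≠ 0) :
    ∃ Δ : Derivation k R R, Δ ≠ 0 ∧ (∀ r, ∃ n, Δ^[n] r = 0) ∧ ∀ r, D (ι r) = 0 → Δ r = 0 := by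
  classical
  have : CharZero R := charZero_of_injective_algebraMap (algebraMap k R).injective
  have hex := E.exists_d D hD hfg
  have hd := Nat.find_spec hex
  have hmin := fun m => Nat.find_min hex (m := m)
  generalize Nat.find hex = d at hd hmin
  obtain ⟨h1, h2⟩ := hd
  let Δ : Derivation k R R := Derivation.mk' (E.cf d ∘ₗ D ∘ₗ ι.toLinearMap) (by
    intro a b
    have a1 : E.L d (D (ι a)) _ := ⟨h1 a, rfl⟩
    have b1 : E.L d (D (ι b)) _ := ⟨h1 b, rfl⟩
    have := ((a1.mul (E.L_ι b)).add (b1.ι_mul a)).2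
    simp only [LinearMap.comp_apply, AlgHom.toLinearMap_apply, map_mul, hD, smul_eq_mul]
    rw [add_zero] at this
    rw [this]; ring)
  have hΔ : ∀ r, Δ r = E.cf d (D (ι r)) := fun r => rfl
  set c := E.cf (d + 1) (D x) with hc
  have key : ∀ m n t v, E.L n t v → E.L (n + m * d) (D^[m] t) (PP d Δ c n m v) := by
    intro m
    induction m with
    | zero => intro n t v h; simpa [PP] using h
    | succ m ih =>
      intro n t v h
      have := ih _ _ _ (E.L_D D hD h1 h2 h)
      rw [Function.iterate_succ_apply]
      rw [show n + (m + 1) * d = n + d + m * d by ring]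
      exact this
  have hl : ∀ n r, ∃ m, PP d Δ c n m r = 0 := by
    intro n r
    obtain ⟨m, hm⟩ := hN (ι r * x ^ n)
    refine ⟨m, ?_⟩
    have := (key m n _ _ (E.L_mono r n)).2
    rw [hm, map_zero] at this
    exact this.symm
  have hc0 : c = 0 := PP_c_zero d c (Δ := Δ) (by simp) (by
    intro a b; rw [Derivation.leibniz]; simp only [smul_eq_mul]; ring) hl
  refine ⟨Δ, ?_, ?_, ?_⟩
  · intro h0
    have h0' : ∀ r, E.cf d (D (ι r)) = 0 := fun r => by rw [← hΔ, h0]; rfl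
    rcases d with _ | e
    · obtain ⟨r, hr⟩ := hne
      apply hr
      have : E.L 0 (D (ι r)) 0 := ⟨h1 r, h0' r⟩
      simpa using this.eq_ι
    · apply hmin e (by omega)
      refine ⟨fun r m hm => ?_, fun m hm => ?_⟩
      · rcases (show m = e + 1 ∨ e + 1 < m by omega) with rfl | h
        · exact h0' r
        · exact h1 r m h
      · rcases (show m = e + 1 + 1 ∨ e + 1 + 1 < m by omega) with rfl | h
        · exact hc0
        · exact h2 m h
  · intro r
    obtain ⟨m, hm⟩ := hl 0 r
    refine ⟨m, ?_⟩
    have : ∀ m n r, PP d Δ c n m r = Δ^[m] r := by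
      intro m
      induction m with
      | zero => intros; rfl
      | succ m ih => intro n r; simp only [PP, Function.iterate_succ_apply, ih]; simp [hc0]
    rw [← this, hm]
  · intro r hr
    rw [hΔ, hr, map_zero]
end Sk

lemma noncomm_alg {k T : Type*} [Field k] [CharZero k] [Ring T] [Algebra k T]
    (D : T →ₗ[k] T) (hD : ∀ a b, D (a * b) = D a * b + a * D b) (b : T) (hb : ∀ t, Commute b t)
    (p : k[X]) (hp : p.Separable) (h : aeval b p = 0) : D b = 0 := by
  have h1 : D 1 = 0 := by have := hD 1 1; simpa using this
  have hpow : ∀ n : ℕ, D (b ^ n) = (n : T) * b ^ (n - 1) * D b := by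
    intro n
    induction n with
    | zero => simpa using h1
    | succ n ih =>
      rw [pow_succ, hD, ih, mul_assoc, ← (hb (D b)).eq]
      rcases n with _ | n
      · simp
      · simp only [Nat.add_sub_cancel]; push_cast; rw [pow_succ]; noncomm_ring
  have key : ∀ q : k[X], D (aeval b q) = aeval b (derivative q) * D b := by
    intro q
    induction q using Polynomial.induction_on' with
    | add p q hp hq => simp only [map_add, hp, hq, add_mul]
    | monomial n r =>
      rw [derivative_monomial, aeval_monomial, aeval_monomial, ← Algebra.smul_def, map_smul, hpow,
        Algebra.smul_def]
      simp [mul_assoc]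
  obtain ⟨u, v, huv⟩ := hp
  have e := congrArg (aeval b) huv
  rw [map_add, map_mul, map_mul, h, mul_zero, zero_add, map_one] at e
  have := key p
  rw [h, map_zero] at this
  calc D b = (aeval b v * aeval b (derivative p)) * D b := by rw [e, one_mul]
    _ = 0 := by rw [mul_assoc, ← this, mul_zero]

lemma equiv_of_range {k A B C : Type*} [Field k] [Ring A] [Ring B] [Ring C] [Algebra k A]
    [Algebra k B] [Algebra k C] (f : A →ₐ[k] C) (g : B →ₐ[k] C) (hf : Function.Injective f)
    (hg : Function.Injective g) (h1 : ∀ a, ∃ b, g b = f a) (h2 : ∀ b, ∃ a, f a = g b) :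
    Nonempty (A ≃ₐ[k] B) := by
  have h : f.range = g.range := by
    ext c
    constructor
    · rintro ⟨a, rfl⟩; exact h1 a
    · rintro ⟨a, rfl⟩; exact h2 a
  exact ⟨((AlgEquiv.ofInjective f hf).trans (Subalgebra.equivOfEq _ _ h)).trans
    (AlgEquiv.ofInjective g hg).symm⟩

lemma half {k R S T T' : Type*} [Field k] [CharZero k]
    [CommRing R] [IsDomain R] [Algebra k R] [CommRing S] [IsDomain S] [Algebra k S]
    [Ring T] [Algebra k T] [Ring T'] [Algebra k T']
    (hfgR : Algebra.FiniteType k R) {δ : Derivation k R R} {δ' : Derivation k S S}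
    {ι : R →ₐ[k] T} {x : T} (E : Sk k R T δ ι x)
    {ι' : S →ₐ[k] T'} {x' : T'} (E' : Sk k S T' δ' ι' x') (φ : T ≃ₐ[k] T') :
    (∀ r, ∃ s, ι' s = φ (ι r)) ∨ ∃ Δ : Derivation k R R, Δ ≠ 0 ∧ (∀ r, ∃ n, Δ^[n] r = 0) ∧
      ∀ r, (∃ s, ι' s = φ (ι r)) → Δ r = 0 := by
  let D : T →ₗ[k] T := φ.symm.toLinearMap ∘ₗ E'.pd ∘ₗ φ.toLinearMap
  have hDa : ∀ t, D t = φ.symm (E'.pd (φ t)) := fun t => rfl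
  by_cases h : ∃ r, D (ι r) ≠ 0
  · right
    obtain ⟨Δ, a, b, c⟩ := E.main_deriv D (by intro a b; simp [hDa, E'.pd_leib]) hfgR (by
      intro t
      obtain ⟨n, hn⟩ := E'.pd_nil (φ t)
      refine ⟨n, ?_⟩
      have : ∀ n t, D^[n] t = φ.symm (E'.pd^[n] (φ t)) := by
        intro n
        induction n with
        | zero => intro t; simp
        | succ n ih => intro t; rw [Function.iterate_succ_apply, ih, hDa]; simp
      rw [this, hn, map_zero]) h
    refine ⟨Δ, a, b, fun r ⟨s, hs⟩ => c r ?_⟩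
    rw [hDa, ← hs, E'.pd_ι, map_zero]
  · left
    push Not at h
    intro r
    apply E'.pd_ker
    have := h r
    rw [hDa] at this
    simpa using this

lemma alg_push {k R S T T' : Type*} [Field k] [CharZero k]
    [CommRing R] [IsDomain R] [Algebra k R] [CommRing S] [IsDomain S] [Algebra k S]
    [Ring T] [Algebra k T] [Ring T'] [Algebra k T']
    {δ : Derivation k R R} {δ' : Derivation k S S}
    {ι : R →ₐ[k] T} {x : T} (E : Sk k R T δ ι x)
    {ι' : S →ₐ[k] T'} (hι' : Function.Injective ι') {x' : T'} (E' : Sk k S T' δ' ι' x')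
    (φ : T ≃ₐ[k] T') (Δ' : Derivation k S S) (b : R) (hb : IsAlgebraic k b) :
    ∃ s, Δ' s = 0 ∧ ι' s = φ (ι b) := by
  have hsep : (minpoly k b).Separable := (minpoly.irreducible hb.isIntegral).separable
  have h0 : aeval b (minpoly k b) = 0 := minpoly.aeval k b
  have hδ : δ b = 0 := noncomm_alg (δ : R →ₗ[k] R) (by
    intro a b; simp [mul_comm, add_comm]) b (fun t => mul_comm _ _) _ hsep h0
  have hcx : Commute (ι b) x := by
    have := E.hcomm b
    rw [hδ, map_zero, add_zero] at this
    exact this.symm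
  have hc : ∀ t, Commute (ι b) t := by
    intro t
    induction t using E.ind with
    | hm r n =>
      refine Commute.mul_right ?_ (hcx.pow_right n)
      show ι b * ι r = ι r * ι b
      rw [← map_mul, mul_comm, map_mul]
    | ha s t hs ht => exact hs.add_right ht
  have hpd : E'.pd (φ (ι b)) = 0 := by
    refine noncomm_alg _ E'.pd_leib _ (fun t => ?_) _ hsep ?_
    · have := (hc (φ.symm t)).map φ
      simpa using this
    · have : aeval (φ (ι b)) (minpoly k b) = φ (ι (aeval b (minpoly k b))) := by
        rw [← aeval_algHom_apply, ← aeval_algHom_apply]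
      rw [this, h0, map_zero, map_zero]
  obtain ⟨s, hs⟩ := E'.pd_ker _ hpd
  refine ⟨s, ?_, hs⟩
  refine noncomm_alg (Δ' : S →ₗ[k] S) (by
    intro a b; simp [mul_comm, add_comm]) s (fun t => mul_comm _ _) _ hsep ?_
  apply hι'
  rw [map_zero, ← aeval_algHom_apply, hs, aeval_algHom_apply, aeval_algHom_apply, h0, map_zero,
    map_zero]

lemma not_case {k R S T' : Type*} [Field k] [CharZero k]
    [CommRing R] [IsDomain R] [Algebra k R] [CommRing S] [IsDomain S] [Algebra k S]
    [Ring T'] [Algebra k T'] (hdimR : ringKrullDim R = 1)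
    (hfgS : Algebra.FiniteType k S) (hdimS : ringKrullDim S = 1)
    (f : R →ₐ[k] T') (hf : Function.Injective f)
    (ι' : S →ₐ[k] T') (h1 : ∀ r, ∃ s, ι' s = f r)
    (Δ : Derivation k S S) (h0 : Δ ≠ 0) (hl : ∀ r, ∃ n, Δ^[n] r = 0)
    (h2 : ∀ r s, ι' s = f r → Δ s = 0) : False := by
  have halg := ker_alg Δ hfgS hdimS h0 hl
  have : Algebra.IsAlgebraic k R := ⟨by
    intro r
    obtain ⟨s, hs⟩ := h1 r
    have ha : IsAlgebraic k (⟨s, h2 r s hs⟩ : kerD Δ) := halg.isAlgebraic _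
    have h3 : IsAlgebraic k s := ha.algHom (kerD Δ).val
    have h4 : IsAlgebraic k (ι' s) := h3.algHom ι'
    rw [hs] at h4
    exact (isAlgebraic_algHom_iff f hf).1 h4⟩
  have hF : IsField R := isField_of_isIntegral_of_isField' (Field.toIsField k)
  rw [ringKrullDim_eq_zero_of_isField hF] at hdimR
  exact zero_ne_one hdimR


/-- Skew cancellation, derivation type, characteristic zero: if `R`, `S` are
affine commutative domains of Krull dimension one over a field `k` of
characteristic zero with `k`-derivations `δ`, `δ'`, and the skew polynomial
rings `R[x; δ]` and `S[x'; δ']` are isomorphic as `k`-algebras, then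
`R ≅ S`. -/
theorem stmt_16 (k R S T T' : Type*) [Field k] [CharZero k]
    [CommRing R] [IsDomain R] [Algebra k R]
    [CommRing S] [IsDomain S] [Algebra k S]
    [Ring T] [Algebra k T] [Ring T'] [Algebra k T']
    (hfgR : Algebra.FiniteType k R) (hdimR : ringKrullDim R = 1)
    (hfgS : Algebra.FiniteType k S) (hdimS : ringKrullDim S = 1)
    (δ : Derivation k R R) (δ' : Derivation k S S)
    (ι : R →ₐ[k] T) (hι : Function.Injective ι) (x : T)
    (hrep : ∀ t : T, ∃! b : ℕ →₀ R, t = b.sum fun i r => ι r * x ^ i)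
    (hcomm : ∀ r : R, x * ι r = ι r * x + ι (δ r))
    (ι' : S →ₐ[k] T') (hι' : Function.Injective ι') (x' : T')
    (hrep' : ∀ t : T', ∃! b : ℕ →₀ S, t = b.sum fun i s => ι' s * x' ^ i)
    (hcomm' : ∀ s : S, x' * ι' s = ι' s * x' + ι' (δ' s))
    (hiso : Nonempty (T ≃ₐ[k] T')) :
    Nonempty (R ≃ₐ[k] S) := by
  obtain ⟨φ⟩ := hiso
  obtain ⟨E⟩ := exists_Sk δ ι x hrep hcomm
  obtain ⟨E'⟩ := exists_Sk δ' ι' x' hrep' hcomm'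
  have hinj : Function.Injective ((φ : T →ₐ[k] T').comp ι) := φ.injective.comp hι
  have hinj' : Function.Injective ((φ.symm : T' →ₐ[k] T).comp ι') := φ.symm.injective.comp hι'
  have hsw : ∀ r s, ι r = φ.symm (ι' s) ↔ ι' s = φ (ι r) := by
    intro r s
    rw [AlgEquiv.eq_symm_apply, eq_comm]
  rcases half hfgR E E' φ with h | ⟨Δ, a, b, c⟩ <;>
    rcases half hfgS E' E φ.symm with h' | ⟨Δ', a', b', c'⟩
  · refine equiv_of_range _ _ hinj hι' h fun s => ?_
    obtain ⟨r, hr⟩ := h' s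
    exact ⟨r, ((hsw _ _).1 hr).symm⟩
  · exact (not_case hdimR hfgS hdimS _ hinj ι' h Δ' a' b'
      fun r s hs => c' s ⟨r, (hsw _ _).2 hs⟩).elim
  · exact (not_case hdimS hfgR hdimR _ hinj' ι h' Δ a b
      fun s r hs => c r ⟨s, (hsw _ _).1 hs⟩).elim
  · obtain ⟨e1⟩ := equiv_poly Δ hfgR hdimR a b
    obtain ⟨e2⟩ := equiv_poly Δ' hfgS hdimS a' b'
    have A1 := ker_alg Δ hfgR hdimR a b
    have A2 := ker_alg Δ' hfgS hdimS a' b'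
    obtain ⟨e⟩ := equiv_of_range (((φ : T →ₐ[k] T').comp ι).comp (kerD Δ).val)
      (ι'.comp (kerD Δ').val) (hinj.comp Subtype.val_injective)
      (hι'.comp Subtype.val_injective)
      (by
        intro r
        obtain ⟨s, hs, hs'⟩ := alg_push E hι' E' φ Δ' r.1 ((A1.isAlgebraic r).algHom (kerD Δ).val)
        exact ⟨⟨s, hs⟩, hs'⟩)
      (by
        intro s
        obtain ⟨r, hr, hr'⟩ := alg_push E' hι E φ.symm Δ s.1
          ((A2.isAlgebraic s).algHom (kerD Δ').val)
        exact ⟨⟨r, hr⟩, ((hsw _ _).1 hr').symm⟩)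
    exact ⟨(e1.symm.trans (Polynomial.mapAlgEquiv e)).trans e2⟩
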